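/- Correctness of the generalized vec trick (algebraic core of Theorem 1): Let M ∈ ℝ^{a×b} and N ∈ ℝ^{c×d} be real matrices, let p : [f] → [a], q : [f] → [c], r : [e] → [b], t : [e] → [d] be index sequences, and let v ∈ ℝ^e. Define the matrix V ∈ ℝ^{d×b} by V_{j,i} = Σ_{l ∈ [e], t(l)=j, r(l)=i} v_l. Then for every h ∈ [f], Σ_{l∈[e]} M_{p(h), r(l)} · N_{q(h), t(l)} · v_l = (N·V·Mᵀ)_{q(h), p(h)}. In other words, the product R(M⊗N)Cᵀv, whose h-th entry is Σ_{l} M_{p(h),r(l)}·N_{q(h),t(l)}·v_l, can be computed entrywise as entries of the matrix N·V·Mᵀ, where vec(V) = Cᵀv. -/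

import Mathlib

open Matrix

/-- Algebraic core of the generalized vec trick (Theorem 1): with
`V j i = Σ_{l : t l = j, r l = i} v l` (so that `vec(V) = Cᵀ v`), the `h`-th entry of
`R (M ⊗ N) Cᵀ v`, namely `Σ_l M (p h) (r l) * N (q h) (t l) * v l`, equals
`(N * V * Mᵀ) (q h) (p h)`. -/
theorem generalized_vec_trick (a b c d e f : ℕ)
    (M : Matrix (Fin a) (Fin b) ℝ) (N : Matrix (Fin c) (Fin d) ℝ)
    (p : Fin f → Fin a) (q : Fin f → Fin c)
    (r : Fin e → Fin b) (t : Fin e → Fin d)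
    (v : Fin e → ℝ)
    (V : Matrix (Fin d) (Fin b) ℝ)
    (hV : ∀ j i, V j i = ∑ l : Fin e, if t l = j ∧ r l = i then v l else 0)
    (h : Fin f) :
    ∑ l : Fin e, M (p h) (r l) * N (q h) (t l) * v l
      = (N * V * Mᵀ) (q h) (p h) := by
  simp only [Matrix.mul_apply, Matrix.transpose_apply, hV, Finset.mul_sum, Finset.sum_mul]
  have hswap : ∀ i : Fin b, (∑ j : Fin d, ∑ l : Fin e,
      N (q h) j * (if t l = j ∧ r l = i then v l else 0) * M (p h) i)
      = ∑ l : Fin e, ∑ j : Fin d,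
      N (q h) j * (if t l = j ∧ r l = i then v l else 0) * M (p h) i :=
    fun i => Finset.sum_comm
  simp only [hswap]
  rw [Finset.sum_comm]
  refine Finset.sum_congr rfl fun l _ => ?_
  rw [Finset.sum_eq_single (r l), Finset.sum_eq_single (t l)]
  · simp only [and_self, if_true]
    ring
  · intro j _ hj
    simp [hj.symm]
  · simp
  · intro i _ hi
    simp [hi.symm]
  · simp
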